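/- arXiv:2103.09875 — 3 statements merged into one kernel-verified Lean document; each statement's English description precedes it below -/
import Mathlib

section
/- Let J be a closed interval or a circle and n ≥ 3. Then the set of injective maps in the space CBVⁿ_ℝ(J) of continuous maps J → ℝⁿ of bounded variation is dense in CBVⁿ_ℝ(J) with respect to the total variation norm ‖F‖_bv = sup_J |F| + var F. -/
open Set Module
open scoped NNReal ENNReal Topology

theorem eVariationOn_add_le {α E : Type*} [LinearOrder α] [SeminormedAddCommGroup E]
    (f g : α → E) (s : Set α) :
    eVariationOn (fun t => f t + g t) s ≤ eVariationOn f s + eVariationOn g s := by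
  refine iSup_le fun p => ?_
  calc ∑ i ∈ Finset.range p.1, edist (f (p.2.1 (i + 1)) + g (p.2.1 (i + 1)))
          (f (p.2.1 i) + g (p.2.1 i))
      ≤ ∑ i ∈ Finset.range p.1, (edist (f (p.2.1 (i + 1))) (f (p.2.1 i)) +
          edist (g (p.2.1 (i + 1))) (g (p.2.1 i))) :=
        Finset.sum_le_sum fun i _ => edist_add_add_le _ _ _ _
    _ ≤ eVariationOn f s + eVariationOn g s := by
        rw [Finset.sum_add_distrib]
        exact add_le_add (eVariationOn.sum_le p.2.2.1 p.2.2.2)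
          (eVariationOn.sum_le p.2.2.1 p.2.2.2)

theorem BoundedVariationOn.add_fun {α E : Type*} [LinearOrder α] [SeminormedAddCommGroup E]
    {f g : α → E} {s : Set α} (hf : BoundedVariationOn f s) (hg : BoundedVariationOn g s) :
    BoundedVariationOn (fun t => f t + g t) s :=
  ne_top_of_le_ne_top (ENNReal.add_ne_top.2 ⟨hf, hg⟩) (eVariationOn_add_le f g s)

theorem LipschitzWith.eVariationOn_Icc_le {E : Type*} [PseudoEMetricSpace E] {h : ℝ → E} {K : ℝ≥0}
    (hh : LipschitzWith K h) (a b : ℝ) :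
    eVariationOn h (Icc a b) ≤ K * ENNReal.ofReal (b - a) := by
  rw [← eVariationOn_id_Icc]
  exact (hh.lipschitzOnWith (s := univ)).comp_eVariationOn_le (g := id) (mapsTo_univ _ _)

theorem LipschitzWith.boundedVariationOn_Icc {E : Type*} [PseudoEMetricSpace E] {h : ℝ → E}
    {K : ℝ≥0} (hh : LipschitzWith K h) (a b : ℝ) : BoundedVariationOn h (Icc a b) :=
  ne_top_of_le_ne_top (by finiteness) (hh.eVariationOn_Icc_le a b)

/-- The bounded variation norm of a bounded Lipschitz map on a compact interval. -/
theorem LipschitzWith.iSup_norm_add_eVariationOn_le {E : Type*} [SeminormedAddCommGroup E]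
    {h : ℝ → E} {K : ℝ≥0} (hh : LipschitzWith K h) {a b M : ℝ} (hM₀ : 0 ≤ M)
    (hM : ∀ t ∈ Icc a b, ‖h t‖ ≤ M) :
    (⨆ t : Icc a b, ‖h t‖) + (eVariationOn h (Icc a b)).toReal ≤ M + K * |b - a| := by
  refine add_le_add (Real.iSup_le (fun t => hM t t.2) hM₀) ?_
  refine (ENNReal.toReal_mono (by finiteness) (hh.eVariationOn_Icc_le a b)).trans ?_
  rw [ENNReal.toReal_mul, ENNReal.coe_toReal]
  gcongr
  rw [ENNReal.toReal_ofReal']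
  exact max_le (le_abs_self _) (abs_nonneg _)

/-- A map of bounded variation paired with a `1`-Lipschitz function factors on `J` through a
Lipschitz map defined on a subset of the line. -/
theorem BoundedVariationOn.exists_lipschitzOnWith_image_eq {E : Type*} [PseudoMetricSpace E]
    {γ : ℝ → E} {f : ℝ → ℝ} {J : Set ℝ} (hγ : BoundedVariationOn γ J) (hf : LipschitzWith 1 f) :
    ∃ (r : ℝ → E × ℝ) (S : Set ℝ), LipschitzOnWith 1 r S ∧ (fun t => (γ t, f t)) '' J = r '' S := by
  rcases J.eq_empty_or_nonempty with rfl | ⟨a, ha⟩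
  · exact ⟨fun t => (γ t, f t), ∅, by simp, by simp⟩
  have hloc := hγ.locallyBoundedVariationOn
  set l : ℝ → ℝ := fun t => t + variationOnFromTo γ J a t with hl
  have key : ∀ s ∈ J, ∀ t ∈ J, s ≤ t →
      |s - t| ≤ |l s - l t| ∧ dist (γ s) (γ t) ≤ |l s - l t| := by
    intro s hs t ht hst
    have h1 : variationOnFromTo γ J a t - variationOnFromTo γ J a s = variationOnFromTo γ J s t :=
      variationOnFromTo.sub_right hloc ha ht hs
    have h2 : dist (γ s) (γ t) ≤ variationOnFromTo γ J s t := by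
      rw [variationOnFromTo.eq_of_le _ _ hst]
      exact (hγ.mono inter_subset_left).dist_le ⟨hs, le_rfl, hst⟩ ⟨ht, hst, le_rfl⟩
    have h3 : l s - l t ≤ 0 := by simp only [hl]; linarith [dist_nonneg (x := γ s) (y := γ t)]
    rw [abs_of_nonpos (sub_nonpos.2 hst), abs_of_nonpos h3]
    simp only [hl]
    constructor <;> linarith [dist_nonneg (x := γ s) (y := γ t)]
  have key' : ∀ s ∈ J, ∀ t ∈ J, |s - t| ≤ |l s - l t| ∧ dist (γ s) (γ t) ≤ |l s - l t| := by
    intro s hs t ht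
    rcases le_total s t with hst | hst
    · exact key s hs t ht hst
    · rw [abs_sub_comm s, abs_sub_comm (l s), dist_comm]
      exact key t ht s hs hst
  have hinj : InjOn l J := by
    intro s hs t ht hst
    have := (key' s hs t ht).1
    rw [hst, sub_self, abs_zero] at this
    exact sub_eq_zero.1 (abs_nonpos_iff.1 this)
  have hinv := hinj.leftInvOn_invFunOn
  refine ⟨(fun t => (γ t, f t)) ∘ Function.invFunOn l J, l '' J, ?_, ?_⟩
  · refine LipschitzOnWith.of_dist_le_mul ?_
    rintro _ ⟨s, hs, rfl⟩ _ ⟨t, ht, rfl⟩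
    simp only [Function.comp_apply, hinv hs, hinv ht, NNReal.coe_one, one_mul, Prod.dist_eq]
    have hfst := hf.dist_le_mul s t
    rw [NNReal.coe_one, one_mul] at hfst
    exact max_le (key' s hs t ht).2 (hfst.trans (key' s hs t ht).1)
  · rw [image_comp, hinv.image_image]

theorem dimH_image_prod_image_le_two {X : Type*} [MetricSpace X] {r : ℝ → X} {S : Set ℝ} {C : ℝ≥0}
    (hr : LipschitzOnWith C r S) : dimH ((r '' S) ×ˢ (r '' S)) ≤ 2 := by
  rw [prod_image_image_eq]
  have h : LipschitzOnWith C (fun p : ℝ × ℝ => (r p.1, r p.2)) (S ×ˢ S) := by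
    refine LipschitzOnWith.of_dist_le_mul fun p hp q hq => ?_
    simp only [Prod.dist_eq]
    refine max_le ((hr.dist_le_mul _ hp.1 _ hq.1).trans ?_)
      ((hr.dist_le_mul _ hp.2 _ hq.2).trans ?_)
    · gcongr; exact le_max_left _ _
    · gcongr; exact le_max_right _ _
  refine h.dimH_image_le.trans ((dimH_mono (subset_univ _)).trans ?_)
  rw [Real.dimH_univ_eq_finrank (ℝ × ℝ)]
  norm_num [finrank_prod]

/-- A generic small multiple of a Lipschitz function `f` perturbs a map of bounded variation so
that all pairs of points separated by `f` are separated by the perturbed map. -/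
theorem BoundedVariationOn.exists_norm_lt_forall_add_smul_ne {E : Type*} [NormedAddCommGroup E]
    [NormedSpace ℝ E] [FiniteDimensional ℝ E] (hE : 3 ≤ finrank ℝ E) {γ : ℝ → E} {f : ℝ → ℝ}
    {J : Set ℝ} (hγ : BoundedVariationOn γ J) (hf : LipschitzWith 1 f) {δ : ℝ} (hδ : 0 < δ) :
    ∃ v : E, ‖v‖ < δ ∧ ∀ s ∈ J, ∀ t ∈ J, f s ≠ f t → γ s + f s • v ≠ γ t + f t • v := by
  obtain ⟨r, S, hr, hrS⟩ := hγ.exists_lipschitzOnWith_image_eq hf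
  set T : Set ((E × ℝ) × (E × ℝ)) := (r '' S) ×ˢ (r '' S)
  set T' := T ∩ {p | p.1.2 ≠ p.2.2}
  set slope : (E × ℝ) × (E × ℝ) → E := fun p => (p.2.2 - p.1.2)⁻¹ • (p.1.1 - p.2.1)
  have hdim : dimH (slope '' T') < finrank ℝ E := by
    have h1 : dimH (slope '' T') ≤ dimH T' := by
      refine dimH_image_le_of_locally_lipschitzOn fun p hp => ?_
      have hne : p.2.2 - p.1.2 ≠ 0 := sub_ne_zero.2 hp.2.symm
      have hc : ContDiffAt ℝ 1 slope p := by
        refine ContDiffAt.smul (ContDiffAt.inv ?_ hne) ?_ <;> fun_prop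
      obtain ⟨K, t, ht, hK⟩ := hc.exists_lipschitzOnWith
      exact ⟨K, t, mem_nhdsWithin_of_mem_nhds ht, hK⟩
    have h2 : dimH T' ≤ 2 := (dimH_mono inter_subset_left).trans (dimH_image_prod_image_le_two hr)
    refine (h1.trans h2).trans_lt ?_
    exact_mod_cast (show 2 < finrank ℝ E by omega)
  obtain ⟨v, hv, hvδ⟩ :=
    (dense_compl_of_dimH_lt_finrank hdim).exists_mem_open Metric.isOpen_ball
      ⟨0, Metric.mem_ball_self hδ⟩
  refine ⟨v, mem_ball_zero_iff.1 hvδ, fun s hs t ht hst heq => hv ?_⟩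
  refine ⟨((γ s, f s), (γ t, f t)), ⟨⟨?_, ?_⟩, hst⟩, ?_⟩
  · exact hrS ▸ mem_image_of_mem _ hs
  · exact hrS ▸ mem_image_of_mem _ ht
  · have hne : f t - f s ≠ 0 := sub_ne_zero.2 hst.symm
    have h : γ s - γ t = (f t - f s) • v := by
      rw [sub_smul, sub_eq_sub_iff_add_eq_add, heq, add_comm]
    simp only [slope, h, inv_smul_smul₀ hne]

theorem LipschitzWith.smul_const {E : Type*} [NormedAddCommGroup E] [NormedSpace ℝ E] {f : ℝ → ℝ}
    (hf : LipschitzWith 1 f) (v : E) : LipschitzWith ‖v‖₊ (fun t => f t • v) := by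
  refine LipschitzWith.of_dist_le_mul fun s t => ?_
  rw [dist_eq_norm, ← sub_smul, norm_smul, mul_comm, coe_nnnorm, ← dist_eq_norm]
  have h := hf.dist_le_mul s t
  rw [NNReal.coe_one, one_mul] at h
  gcongr

theorem Real.eq_of_cos_eq_of_sin_eq {s t : ℝ} (hs : s ∈ Ico 0 (2 * Real.pi))
    (ht : t ∈ Ico 0 (2 * Real.pi)) (hcos : Real.cos s = Real.cos t)
    (hsin : Real.sin s = Real.sin t) : s = t := by
  have h : Real.cos (s - t) = 1 := by
    rw [Real.cos_sub, hcos, hsin, ← sq, ← sq, Real.cos_sq_add_sin_sq]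
  exact sub_eq_zero.1 ((Real.cos_eq_one_iff_of_lt_of_lt (by linarith [hs.1, ht.2])
    (by linarith [hs.2, ht.1])).1 h)

/-- For `J` a closed interval or a circle (the latter modeled by `2π`-periodic maps on `ℝ`)
and `n ≥ 3`, the injective maps in `CBVⁿ_ℝ(J)` are dense in `CBVⁿ_ℝ(J)` for the total
variation norm `‖F‖_bv = sup_J ‖F‖ + var F`. -/
theorem stmt_9 {n : ℕ} (hn : 3 ≤ n) :
    (∀ (a b : ℝ) (γ : ℝ → EuclideanSpace ℝ (Fin n)),
      ContinuousOn γ (Icc a b) → BoundedVariationOn γ (Icc a b) → ∀ ε > (0 : ℝ),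
      ∃ σ : ℝ → EuclideanSpace ℝ (Fin n),
        ContinuousOn σ (Icc a b) ∧ BoundedVariationOn σ (Icc a b) ∧ InjOn σ (Icc a b) ∧
        BoundedVariationOn (fun t => γ t - σ t) (Icc a b) ∧
        (⨆ t : Icc a b, ‖γ t - σ t‖) +
          (eVariationOn (fun t => γ t - σ t) (Icc a b)).toReal < ε)
    ∧
    (∀ γ : ℝ → EuclideanSpace ℝ (Fin n), Continuous γ →
      (∀ t, γ (t + 2 * Real.pi) = γ t) →
      BoundedVariationOn γ (Icc 0 (2 * Real.pi)) → ∀ ε > (0 : ℝ),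
      ∃ σ : ℝ → EuclideanSpace ℝ (Fin n),
        Continuous σ ∧ (∀ t, σ (t + 2 * Real.pi) = σ t) ∧
        BoundedVariationOn σ (Icc 0 (2 * Real.pi)) ∧ InjOn σ (Ico 0 (2 * Real.pi)) ∧
        BoundedVariationOn (fun t => γ t - σ t) (Icc 0 (2 * Real.pi)) ∧
        (⨆ t : Icc 0 (2 * Real.pi), ‖γ t - σ t‖) +
          (eVariationOn (fun t => γ t - σ t) (Icc 0 (2 * Real.pi))).toReal < ε) := by
  have hE : 3 ≤ finrank ℝ (EuclideanSpace ℝ (Fin n)) := by simpa using hn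
  constructor
  · intro a b γ hc hγ ε hε
    set L : ℝ := |a| + |b| + |b - a| with hL
    have hL₀ : 0 ≤ L := by positivity
    obtain ⟨v, hv, hne⟩ := hγ.exists_norm_lt_forall_add_smul_ne hE LipschitzWith.id
      (show 0 < ε / (L + 1) by positivity)
    have hlip : LipschitzWith ‖v‖₊ (fun t : ℝ => t • v) := LipschitzWith.id.smul_const v
    have hdiff : (fun t => γ t - (γ t + t • v)) = fun t => -(t • v) := by
      funext t; abel
    have hnorm : ∀ t ∈ Icc a b, ‖-(t • v)‖ ≤ (|a| + |b|) * ‖v‖ := by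
      intro t ht
      rw [norm_neg, norm_smul, Real.norm_eq_abs]
      gcongr
      exact (abs_le_max_abs_abs ht.1 ht.2).trans
        (max_le_add_of_nonneg (abs_nonneg _) (abs_nonneg _))
    refine ⟨fun t => γ t + t • v, hc.add hlip.continuous.continuousOn,
      hγ.add_fun (hlip.boundedVariationOn_Icc a b), ?_, ?_, ?_⟩
    · intro s hs t ht hst
      by_contra h
      exact hne s hs t ht h hst
    · exact hdiff ▸ hlip.neg.boundedVariationOn_Icc a b
    · simp only [sub_add_cancel_left]
      refine (hlip.neg.iSup_norm_add_eVariationOn_le (by positivity) hnorm).trans_lt ?_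
      rw [coe_nnnorm]
      rw [lt_div_iff₀ (by positivity)] at hv
      nlinarith [norm_nonneg v]
  · intro γ hc hper hγ ε hε
    have hπ := Real.pi_pos
    set δ : ℝ := ε / (2 * (1 + 2 * Real.pi)) with hδ
    have hδ₀ : 0 < δ := by positivity
    obtain ⟨v, hv, hvne⟩ :=
      hγ.exists_norm_lt_forall_add_smul_ne hE Real.lipschitzWith_cos hδ₀
    have hlv := Real.lipschitzWith_cos.smul_const v
    obtain ⟨w, hw, hwne⟩ := (hγ.add_fun (hlv.boundedVariationOn_Icc 0 (2 * Real.pi))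
      ).exists_norm_lt_forall_add_smul_ne hE Real.lipschitzWith_sin hδ₀
    have hlw := Real.lipschitzWith_sin.smul_const w
    have hlip := (hlv.add hlw).neg
    have hdiff : (fun t => γ t - (γ t + Real.cos t • v + Real.sin t • w)) =
        fun t => -(Real.cos t • v + Real.sin t • w) := by
      funext t; abel
    have hnorm : ∀ t ∈ Icc 0 (2 * Real.pi),
        ‖-(Real.cos t • v + Real.sin t • w)‖ ≤ ‖v‖ + ‖w‖ := by
      intro t _
      rw [norm_neg]
      refine (norm_add_le _ _).trans (add_le_add ?_ ?_) <;> rw [norm_smul, Real.norm_eq_abs]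
      · exact mul_le_of_le_one_left (norm_nonneg _) (Real.abs_cos_le_one t)
      · exact mul_le_of_le_one_left (norm_nonneg _) (Real.abs_sin_le_one t)
    refine ⟨fun t => γ t + Real.cos t • v + Real.sin t • w,
      (hc.add hlv.continuous).add hlw.continuous, fun t => ?_,
      (hγ.add_fun (hlv.boundedVariationOn_Icc _ _)).add_fun (hlw.boundedVariationOn_Icc _ _),
      ?_, ?_, ?_⟩
    · simp only [hper, Real.cos_add_two_pi, Real.sin_add_two_pi]
    · intro s hs t ht hst
      have hs' := Ico_subset_Icc_self hs
      have ht' := Ico_subset_Icc_self ht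
      by_contra h
      have hsin : Real.sin s = Real.sin t := by
        by_contra hsin
        exact hwne s hs' t ht' hsin hst
      have hcos : Real.cos s = Real.cos t := by
        by_contra hcos
        simp only [hsin, add_left_inj] at hst
        exact hvne s hs' t ht' hcos hst
      exact h (Real.eq_of_cos_eq_of_sin_eq hs ht hcos hsin)
    · exact hdiff ▸ hlip.boundedVariationOn_Icc _ _
    · have hsup : ∀ t, ‖γ t - (γ t + Real.cos t • v + Real.sin t • w)‖ =
          ‖-(Real.cos t • v + Real.sin t • w)‖ := fun t => congrArg norm (congrFun hdiff t)
      simp only [hdiff, hsup]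
      refine (hlip.iSup_norm_add_eVariationOn_le (by positivity) hnorm).trans_lt ?_
      rw [sub_zero, abs_of_pos (by positivity), NNReal.coe_add, coe_nnnorm, coe_nnnorm]
      calc ‖v‖ + ‖w‖ + (‖v‖ + ‖w‖) * (2 * Real.pi)
          = (‖v‖ + ‖w‖) * (1 + 2 * Real.pi) := by ring
        _ < (δ + δ) * (1 + 2 * Real.pi) := by gcongr
        _ = ε := by rw [hδ]; field_simp; ring
end

section
/- Let J be a closed interval. The closure of C¹(J) in the space of continuous functions of bounded variation on J, with respect to the total variation norm, is exactly the set of absolutely continuous functions on J. In particular, C¹(J) is not dense in CBV(J). -/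
open Set

/-- `F` is absolutely continuous on `[a,b]`. -/
def ACOn (F : ℝ → ℝ) (a b : ℝ) : Prop :=
  ∀ ε > (0 : ℝ), ∃ δ > (0 : ℝ), ∀ (m : ℕ) (u v : Fin m → ℝ),
    (∀ i, a ≤ u i ∧ u i ≤ v i ∧ v i ≤ b) →
    (Pairwise fun i j => Disjoint (Ioo (u i) (v i)) (Ioo (u j) (v j))) →
    (∑ i, (v i - u i)) < δ → (∑ i, |F (v i) - F (u i)|) < ε

/-- `F` can be approximated arbitrarily well in the total variation norm on `[a,b]`
by functions of class `C¹`. -/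
def C1Approx (F : ℝ → ℝ) (a b : ℝ) : Prop :=
  ∀ ε > (0 : ℝ), ∃ G : ℝ → ℝ, ContDiffOn ℝ 1 G (Icc a b) ∧
    (⨆ t : Icc a b, |F t - G t|) +
      (eVariationOn (fun t => F t - G t) (Icc a b)).toReal < ε

open MeasureTheory Filter Topology

/-- Reordering the endpoints of an interval does not change the absolute increment. -/
lemma abs_sub_max_min (F : ℝ → ℝ) (x y : ℝ) :
    |F (max x y) - F (min x y)| = |F x - F y| := by
  rcases le_total x y with h | h <;> simp [h, abs_sub_comm]

lemma disjoint_Ioo_iff_disjoint_Ioc {u v u' v' : ℝ} :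
    Disjoint (Ioo u v) (Ioo u' v') ↔ Disjoint (Ioc u v) (Ioc u' v') := by
  simp [disjoint_iff_inter_eq_empty, Ioo_inter_Ioo, Ioc_inter_Ioc, Ioo_eq_empty_iff,
    Ioc_eq_empty_iff]

lemma acOn_iff_absolutelyContinuousOnInterval {F : ℝ → ℝ} {a b : ℝ} (hab : a ≤ b) :
    ACOn F a b ↔ AbsolutelyContinuousOnInterval F a b := by
  rw [absolutelyContinuousOnInterval_iff]
  refine forall₂_congr fun ε _ ↦ exists_congr fun δ ↦ and_congr_right fun _ ↦ ?_
  constructor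
  · rintro h ⟨n, I⟩ ⟨hI, hd⟩ hs
    simp only [uIcc_of_le hab, Finset.mem_range, mem_Icc] at hI
    have key := h n (fun i ↦ min (I i).1 (I i).2) (fun i ↦ max (I i).1 (I i).2)
      (fun i ↦ by have := hI i i.2; grind) ?_ ?_
    · simp only [abs_sub_max_min] at key
      simpa only [Finset.sum_range, Real.dist_eq] using key
    · intro i j hij
      rw [disjoint_Ioo_iff_disjoint_Ioc]
      exact hd (by simp) (by simp) (by simpa [Fin.ext_iff] using hij)
    · simpa only [Finset.sum_range, Real.dist_eq, max_sub_min_eq_abs'] using hs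
  · intro h m u v huv hd hs
    have key := h (m, fun i ↦ if hi : i < m then (u ⟨i, hi⟩, v ⟨i, hi⟩) else (a, a)) ?_ ?_
    · simpa [Finset.sum_range, Real.dist_eq, abs_sub_comm] using key
    · refine ⟨fun i hi ↦ ?_, fun i hi j hj hij ↦ ?_⟩
      · have hi' : i < m := by simpa using hi
        have := huv ⟨i, hi'⟩
        simp only [hi', dite_true, uIcc_of_le hab, mem_Icc]
        grind
      · have hi' : i < m := by simpa using hi
        have hj' : j < m := by simpa using hj
        simp only [Function.onFun, hi', hj', dite_true, uIoc_of_le (huv _).2.1]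
        exact disjoint_Ioo_iff_disjoint_Ioc.1 (hd (by simpa [Fin.ext_iff] using hij))
    · simp only [Finset.sum_range, Fin.is_lt, dite_true, Real.dist_eq]
      convert hs using 2 with i
      rw [abs_sub_comm, abs_of_nonneg (by linarith [huv i])]

/-- The increments over finitely many nonoverlapping intervals are bounded by the variation. -/
lemma sum_edist_le_eVariationOn {ι : Type*} (H : ℝ → ℝ) {a : ℝ} (u v : ι → ℝ) (s : Finset ι)
    (hau : ∀ i ∈ s, a ≤ u i) (huv : ∀ i ∈ s, u i < v i)
    (hd : (s : Set ι).Pairwise fun i j ↦ Disjoint (Ioo (u i) (v i)) (Ioo (u j) (v j)))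
    (c : ℝ) (hvc : ∀ i ∈ s, v i ≤ c) :
    ∑ i ∈ s, edist (H (v i)) (H (u i)) ≤ eVariationOn H (Icc a c) := by
  classical
  induction s using Finset.induction_on_max_value v generalizing c with
  | empty => simp
  | insert i s hi hmax ih =>
    have hau' := hau i (by simp)
    have huv' := huv i (by simp)
    have hvc' := hvc i (by simp)
    rw [Finset.sum_insert hi]
    have hrest := ih (fun j hj ↦ hau j (by simp [hj])) (fun j hj ↦ huv j (by simp [hj]))
      (hd.mono (by simp)) (u i) fun j hj ↦ by
        have hij := hd (by simp [hj]) (by simp) (fun h : j = i ↦ hi (h ▸ hj))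
        have h1 := huv j (by simp [hj])
        have h2 := hmax j hj
        simp only [Ioo_disjoint_Ioo] at hij
        grind
    have hlast : edist (H (v i)) (H (u i)) ≤ eVariationOn H (Icc (u i) c) :=
      eVariationOn.edist_le H ⟨huv'.le, hvc'⟩ ⟨le_rfl, huv'.le.trans hvc'⟩
    have := eVariationOn.Icc_add_Icc H (s := univ) hau' (huv'.le.trans hvc') (mem_univ _)
    simp only [univ_inter] at this
    rw [← this, add_comm]
    gcongr

lemma eVariationOn_sub_le (F G : ℝ → ℝ) (s : Set ℝ) :
    eVariationOn (fun t ↦ F t - G t) s ≤ eVariationOn F s + eVariationOn G s := by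
  refine iSup_le fun ⟨n, u, hu, us⟩ ↦ ?_
  calc _ ≤ ∑ i ∈ Finset.range n, (edist (F (u (i + 1))) (F (u i)) +
        edist (G (u (i + 1))) (G (u i))) := by
        gcongr with i
        simp only [edist_dist, Real.dist_eq]
        rw [← ENNReal.ofReal_add (abs_nonneg _) (abs_nonneg _)]
        refine ENNReal.ofReal_le_ofReal (le_trans (le_of_eq ?_) (abs_sub _ _))
        congr 1
        ring
    _ ≤ _ := by
        rw [Finset.sum_add_distrib]
        exact add_le_add (eVariationOn.sum_le hu us) (eVariationOn.sum_le hu us)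

lemma eVariationOn_le_of_abs_sub_le {H W : ℝ → ℝ} {a b : ℝ} (hab : a ≤ b)
    (h : ∀ x ∈ Icc a b, ∀ y ∈ Icc a b, x ≤ y → |H y - H x| ≤ W y - W x) :
    eVariationOn H (Icc a b) ≤ ENNReal.ofReal (W b - W a) := by
  have hW : MonotoneOn W (Icc a b) := fun x hx y hy hxy ↦
    sub_nonneg.1 ((abs_nonneg _).trans (h x hx y hy hxy))
  have hvar := hW.eVariationOn_eq (left_mem_Icc.2 hab) (right_mem_Icc.2 hab)
  rw [inter_self] at hvar
  refine (iSup_le fun ⟨n, u, hu, us⟩ ↦ ?_).trans hvar.le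
  refine le_trans ?_ (eVariationOn.sum_le (n := n) hu us)
  gcongr with i
  simp only [edist_dist, Real.dist_eq]
  exact ENNReal.ofReal_le_ofReal
    ((h _ (us i) _ (us (i + 1)) (hu (Nat.le_succ i))).trans (le_abs_self _))

lemma acOn_of_c1Approx {F : ℝ → ℝ} {a b : ℝ} (hab : a ≤ b)
    (hF : BoundedVariationOn F (Icc a b)) (h : C1Approx F a b) : ACOn F a b := by
  classical
  intro ε hε
  obtain ⟨G, hG, hGε⟩ := h (ε / 2) (by positivity)
  have hGac : AbsolutelyContinuousOnInterval G a b :=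
    ContDiffOn.absolutelyContinuousOnInterval (by rwa [uIcc_of_le hab])
  have hGbv : BoundedVariationOn G (Icc a b) := uIcc_of_le hab ▸ hGac.boundedVariationOn
  obtain ⟨δ, hδ, hGδ⟩ :=
    (acOn_iff_absolutelyContinuousOnInterval hab).2 hGac (ε / 2) (by positivity)
  set H : ℝ → ℝ := fun t ↦ F t - G t with hH
  have hHbv : eVariationOn H (Icc a b) ≠ ⊤ :=
    ne_top_of_le_ne_top (ENNReal.add_ne_top.2 ⟨hF, hGbv⟩) (eVariationOn_sub_le F G _)
  have hvar : (eVariationOn H (Icc a b)).toReal < ε / 2 :=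
    (le_add_of_nonneg_left (Real.iSup_nonneg fun _ ↦ abs_nonneg _)).trans_lt hGε
  refine ⟨δ, hδ, fun m u v huv hd hs ↦ ?_⟩
  have hsum : ∑ i, |H (v i) - H (u i)| ≤ (eVariationOn H (Icc a b)).toReal := by
    have := sum_edist_le_eVariationOn H (a := a) u v {i | u i < v i} (fun i _ ↦ (huv i).1)
      (by simp) (fun i _ j _ hij ↦ hd hij) b (fun i _ ↦ (huv i).2.2)
    rw [Finset.sum_filter_of_ne] at this
    · refine le_trans (le_of_eq ?_) (ENNReal.toReal_mono hHbv this)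
      rw [ENNReal.toReal_sum (fun _ _ ↦ edist_ne_top _ _)]
      simp [edist_dist, Real.dist_eq]
    · intro i _ hi
      refine lt_of_le_of_ne (huv i).2.1 fun heq ↦ hi (by simp [heq])
  calc ∑ i, |F (v i) - F (u i)|
      ≤ ∑ i, (|G (v i) - G (u i)| + |H (v i) - H (u i)|) := by
        gcongr with i
        refine le_trans (le_of_eq ?_) (abs_add_le _ _)
        simp only [hH]
        congr 1
        ring
    _ < ε := by
        rw [Finset.sum_add_distrib]
        linarith [hGδ m u v huv hd hs]

lemma c1Approx_of_acOn {F : ℝ → ℝ} {a b : ℝ} (hab : a ≤ b) (h : ACOn F a b) :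
    C1Approx F a b := by
  intro ε hε
  have hac := (acOn_iff_absolutelyContinuousOnInterval hab).1 h
  have hint := hac.intervalIntegrable_deriv
  obtain ⟨g, -, hgε, hg, hgint⟩ := ((intervalIntegrable_iff_integrableOn_Ioc_of_le hab).1
    hint).integrable.exists_hasCompactSupport_integral_sub_le (show 0 < ε / 3 by positivity)
  have hFTC : ∀ x ∈ Icc a b, F x = F a + ∫ t in a..x, deriv F t := fun x hx ↦ by
    rw [(hac.mono (uIcc_subset_uIcc_left (by rwa [uIcc_of_le hab]))).integral_deriv_eq_sub]
    ring
  let G : ℝ → ℝ := fun x ↦ F a + ∫ t in a..x, g t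
  let W : ℝ → ℝ := fun x ↦ ∫ t in a..x, |deriv F t - g t|
  have hi : ∀ x ∈ Icc a b, ∀ y ∈ Icc a b, IntervalIntegrable (deriv F) volume x y :=
    fun x hx y hy ↦ hint.mono_set (uIcc_subset_uIcc (by rwa [uIcc_of_le hab])
      (by rwa [uIcc_of_le hab]))
  have hgi : ∀ x y, IntervalIntegrable g volume x y := fun x y ↦ hg.intervalIntegrable x y
  have ha : a ∈ Icc a b := left_mem_Icc.2 hab
  have hb : b ∈ Icc a b := right_mem_Icc.2 hab
  have hdiff : ∀ x ∈ Icc a b, F x - G x = ∫ t in a..x, (deriv F t - g t) := fun x hx ↦ by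
    rw [hFTC x hx, intervalIntegral.integral_sub (hi a ha x hx) (hgi _ _)]
    simp only [G]
    ring
  have hinc : ∀ x ∈ Icc a b, ∀ y ∈ Icc a b, x ≤ y →
      |(F y - G y) - (F x - G x)| ≤ W y - W x := fun x hx y hy hxy ↦ by
    have hs : ∀ z ∈ Icc a b, IntervalIntegrable (fun t ↦ deriv F t - g t) volume a z :=
      fun z hz ↦ (hi a ha z hz).sub (hgi _ _)
    rw [hdiff x hx, hdiff y hy, intervalIntegral.integral_interval_sub_left (hs y hy) (hs x hx)]
    simp only [W]
    rw [intervalIntegral.integral_interval_sub_left (hs y hy).abs (hs x hx).abs]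
    exact intervalIntegral.abs_integral_le_integral_abs hxy
  have hWa : W a = 0 := intervalIntegral.integral_same
  have hWb : W b ≤ ε / 3 := by
    simp only [W]
    rw [intervalIntegral.integral_of_le hab]
    exact hgε
  refine ⟨G, ?_, ?_⟩
  · have hGd : ∀ x, HasDerivAt G (g x) x := fun x ↦
      (intervalIntegral.integral_hasDerivAt_right (hgi _ _)
        hg.stronglyMeasurable.stronglyMeasurableAtFilter hg.continuousAt).const_add _
    refine (contDiff_one_iff_deriv.2 ⟨fun x ↦ (hGd x).differentiableAt, ?_⟩).contDiffOn
    rwa [funext fun x ↦ (hGd x).deriv]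
  · have hsup : (⨆ t : Icc a b, |F t - G t|) ≤ ε / 3 := by
      have : Nonempty (Icc a b) := ⟨⟨a, ha⟩⟩
      refine ciSup_le fun t ↦ ?_
      have h1 := hinc a ha t t.2 t.2.1
      have h2 := (abs_nonneg _).trans (hinc t t.2 b hb t.2.2)
      have h3 : F a - G a = 0 := by simp [G]
      rw [h3, sub_zero] at h1
      linarith
    have hvar : (eVariationOn (fun t ↦ F t - G t) (Icc a b)).toReal ≤ ε / 3 :=
      ENNReal.toReal_le_of_le_ofReal (by positivity)
        ((eVariationOn_le_of_abs_sub_le hab hinc).trans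
          (ENNReal.ofReal_le_ofReal (by linarith)))
    linarith

/-- Every nondegenerate compact interval contains a compact set of positive measure which has
empty interior. -/
lemma exists_isCompact_subset_Icc_interior_eq_empty {a b : ℝ} (hab : a < b) :
    ∃ K ⊆ Icc a b, IsCompact K ∧ interior K = ∅ ∧ 0 < volume.real K := by
  have hm : MeasurableSet (Icc a b \ range ((↑) : ℚ → ℝ)) :=
    measurableSet_Icc.diff (countable_range _).measurableSet
  have hpos : 0 < volume (Icc a b \ range ((↑) : ℚ → ℝ)) := by
    rw [measure_sdiff_null ((countable_range _).measure_zero _)]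
    simpa using hab
  obtain ⟨K, hK, hKc, hK0⟩ := hm.exists_lt_isCompact hpos
  refine ⟨K, hK.trans sdiff_subset, hKc, ?_, ENNReal.toReal_pos hK0.ne' hKc.measure_ne_top⟩
  by_contra! hne
  obtain ⟨q, hq⟩ := Rat.denseRange_cast.exists_mem_open isOpen_interior hne
  exact (hK (interior_subset hq)).2 ⟨q, rfl⟩

/-- If `K` is compact with empty interior, some increasing homeomorphism of the line has as its
increment over each interval the measure of the part of that interval outside `K`. -/
lemma exists_orderIso_sub_eq_measureReal_sdiff {K : Set ℝ} (hK : IsCompact K)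
    (hKi : interior K = ∅) :
    ∃ g : ℝ ≃o ℝ, ∀ x y, x ≤ y → g y - g x = volume.real (Ioc x y \ K) := by
  have hKm := hK.measurableSet
  have hKi' : Integrable (K.indicator fun _ ↦ (1 : ℝ)) volume :=
    (integrable_indicator_iff hKm).2 (integrableOn_const hK.measure_ne_top)
  let g : ℝ → ℝ := fun x ↦ x - ∫ t in (0 : ℝ)..x, K.indicator (fun _ ↦ (1 : ℝ)) t
  have hinc : ∀ x y, x ≤ y → g y - g x = volume.real (Ioc x y \ K) := fun x y hxy ↦ by
    have h1 : g y - g x = (y - x) - ∫ t in x..y, K.indicator (fun _ ↦ (1 : ℝ)) t := by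
      rw [← intervalIntegral.integral_interval_sub_left (a := 0) hKi'.intervalIntegrable
        hKi'.intervalIntegrable]
      simp only [g]
      ring
    rw [h1, intervalIntegral.integral_of_le hxy, setIntegral_indicator hKm, setIntegral_const,
      smul_eq_mul, mul_one]
    have := measureReal_sdiff_add_inter (μ := volume) (s := Ioc x y) hKm (by simp)
    rw [Real.volume_real_Ioc_of_le hxy] at this
    linarith
  have hmono : StrictMono g := fun x y hxy ↦ by
    rw [← sub_pos, hinc x y hxy.le]
    have hne : (Ioo x y \ K).Nonempty := by
      rw [sdiff_nonempty]
      intro hsub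
      have := interior_maximal hsub isOpen_Ioo
      rw [hKi, subset_empty_iff, Ioo_eq_empty_iff] at this
      exact this hxy
    have hpos := (isOpen_Ioo.sdiff hK.isClosed).measure_pos volume hne
    refine ENNReal.toReal_pos
      (hpos.trans_le (measure_mono (sdiff_subset_sdiff_left Ioo_subset_Ioc_self))).ne' ?_
    exact measure_ne_top_of_subset sdiff_subset (by simp)
  have hcont : Continuous g :=
    continuous_id.sub (intervalIntegral.continuous_primitive (fun _ _ ↦ hKi'.intervalIntegrable) 0)
  have hbdd : ∀ x, |x - g x| ≤ ∫ t, K.indicator (fun _ ↦ (1 : ℝ)) t := fun x ↦ by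
    have h0 : ∀ t, 0 ≤ K.indicator (fun _ ↦ (1 : ℝ)) t := indicator_nonneg (by simp)
    simp only [g, sub_sub_cancel]
    refine (intervalIntegral.norm_integral_le_integral_norm_uIoc
      (f := K.indicator fun _ ↦ (1 : ℝ))).trans ?_
    simp only [Real.norm_of_nonneg (h0 _)]
    exact setIntegral_le_integral hKi' (Eventually.of_forall h0)
  have hsurj : Function.Surjective g := by
    refine hcont.surjective ?_ ?_
    · refine tendsto_atTop_mono (fun x ↦ ?_)
        (tendsto_atTop_add_const_right _ (-∫ t, K.indicator (fun _ ↦ (1 : ℝ)) t) tendsto_id)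
      have := abs_le.1 (hbdd x)
      simp only [id]
      linarith
    · refine tendsto_atBot_mono (fun x ↦ ?_)
        (tendsto_atBot_add_const_right _ (∫ t, K.indicator (fun _ ↦ (1 : ℝ)) t) tendsto_id)
      have := abs_le.1 (hbdd x)
      simp only [id]
      linarith
  exact ⟨hmono.orderIsoOfSurjective g hsurj, hinc⟩

/-- A compact subset of `[a, b]` admits finitely many nonoverlapping intervals of total length at
least its measure, whose part outside the set is arbitrarily small. -/
lemma exists_intervals_measureReal_le_and_sdiff_lt {a b : ℝ} (hab : a < b) {K : Set ℝ}
    (hK : IsCompact K) (hKab : K ⊆ Icc a b) {η : ℝ} (hη : 0 < η) :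
    ∃ (N : ℕ) (x y : Fin N → ℝ), (∀ i, a ≤ x i ∧ x i ≤ y i ∧ y i ≤ b) ∧
      (Pairwise fun i j ↦ Disjoint (Ioo (x i) (y i)) (Ioo (x j) (y j))) ∧
      volume.real K ≤ ∑ i, (y i - x i) ∧ ∑ i, volume.real (Ioc (x i) (y i) \ K) < η := by
  classical
  obtain ⟨r, hr, hrη⟩ : ∃ r > 0, volume (Metric.cthickening r K) <
      volume K + ENNReal.ofReal η := by
    have hlim := (tendsto_measure_cthickening_of_isCompact (μ := volume) hK).eventually_lt_const
      (ENNReal.lt_add_right hK.measure_ne_top (ENNReal.ofReal_pos.2 hη).ne')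
    obtain ⟨r, hr⟩ := (Metric.eventually_nhds_iff.1 hlim)
    exact ⟨r / 2, by linarith [hr.1], hr.2 (by
      rw [Real.dist_eq, sub_zero, abs_of_pos (by linarith [hr.1])]; linarith [hr.1])⟩
  obtain ⟨N, hN⟩ := exists_nat_gt ((b - a) / r)
  have hba : 0 < b - a := sub_pos.2 hab
  have hN0 : (0 : ℝ) < N := (div_pos hba hr).trans hN
  let p : ℕ → ℝ := fun k ↦ a + k * ((b - a) / N)
  have hstep : ∀ k, p (k + 1) - p k = (b - a) / N := fun k ↦ by simp only [p]; push_cast; ring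
  have hstep_pos : 0 < (b - a) / N := div_pos hba hN0
  have hstep_lt : (b - a) / N < r := by
    rw [div_lt_iff₀ hr] at hN
    rw [div_lt_iff₀ hN0]
    linarith
  have hpmono : Monotone p := monotone_nat_of_le_succ fun k ↦ by linarith [hstep k]
  have hp0 : p 0 = a := by simp [p]
  have hpN : p N = b := by simp only [p]; field_simp; ring
  let T : Set ℕ := {k | (Icc (p k) (p (k + 1)) ∩ K).Nonempty}
  let y : Fin N → ℝ := fun k ↦ if (k : ℕ) ∈ T then p (k + 1) else p k
  have hy : ∀ k : Fin N, p k ≤ y k ∧ y k ≤ p (k + 1) := fun k ↦ by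
    have := hpmono (Nat.le_succ k)
    simp only [y]
    split_ifs <;> simp_all
  have hdisj : Pairwise fun i j : Fin N ↦ Disjoint (Ioc (p i) (y i)) (Ioc (p j) (y j)) := by
    intro i j hij
    refine (hpmono.pairwise_disjoint_on_Ioc_succ (Fin.val_ne_of_ne hij)).mono ?_ ?_
    · exact Ioc_subset_Ioc_right (hy i).2
    · exact Ioc_subset_Ioc_right (hy j).2
  refine ⟨N, fun k ↦ p k, y, fun k ↦ ⟨?_, (hy k).1, ?_⟩, ?_, ?_, ?_⟩
  · exact hp0 ▸ hpmono (Nat.zero_le _)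
  · exact (hy k).2.trans (hpN ▸ hpmono k.2)
  · exact fun i j hij ↦ disjoint_Ioo_iff_disjoint_Ioc.2 (hdisj hij)
  · have hcover : K ⊆ ⋃ k ∈ (Finset.univ : Finset (Fin N)), Icc (p k) (y k) := by
      intro z hz
      have hz' := hKab hz
      have hex : ∃ k : Fin N, z ∈ Icc (p k) (p (k + 1)) := by
        have hexN : ∃ n, z ≤ p (n + 1) :=
          ⟨N, hz'.2.trans (hpN ▸ hpmono (Nat.le_succ N))⟩
        have hmin := Nat.find_spec hexN
        have hpk : p (Nat.find hexN) ≤ z := by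
          rcases Nat.eq_zero_or_eq_succ_pred (Nat.find hexN) with h0 | h0
          · rw [h0, hp0]; exact hz'.1
          · have := Nat.find_min hexN (m := (Nat.find hexN).pred) (by omega)
            rw [h0]; exact (not_le.1 this).le
        have hlt : Nat.find hexN < N := by
          have hN1 : N - 1 + 1 = N := Nat.sub_add_cancel (by exact_mod_cast hN0)
          have := Nat.find_min' hexN (m := N - 1) (by rw [hN1, hpN]; exact hz'.2)
          omega
        exact ⟨⟨_, hlt⟩, hpk, hmin⟩
      obtain ⟨k, hk⟩ := hex
      have hkT : (k : ℕ) ∈ T := ⟨z, hk, hz⟩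
      simp only [Finset.mem_univ, iUnion_true, mem_iUnion]
      exact ⟨k, by simpa [y, hkT] using hk⟩
    calc volume.real K ≤ volume.real (⋃ k ∈ (Finset.univ : Finset (Fin N)), Icc (p k) (y k)) :=
          measureReal_mono hcover
            ((measure_biUnion_lt_top (Finset.finite_toSet _) (by simp)).ne)
      _ ≤ ∑ k : Fin N, volume.real (Icc (p k) (y k)) := measureReal_biUnion_finset_le _ _
      _ = ∑ k : Fin N, (y k - p k) :=
          Finset.sum_congr rfl fun k _ ↦ Real.volume_real_Icc_of_le (hy k).1
  · have hKfin := hK.measure_ne_top (μ := volume)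
    have hthick : volume (Metric.cthickening r K) ≠ ⊤ := hrη.ne_top
    have hsub : (⋃ k ∈ (Finset.univ : Finset (Fin N)), (Ioc (p k) (y k) \ K)) ⊆
        Metric.cthickening r K \ K := by
      simp only [Finset.mem_univ, iUnion_true, iUnion_subset_iff]
      refine fun k ↦ sdiff_subset_sdiff_left fun z hz ↦ ?_
      by_cases hkT : (k : ℕ) ∈ T
      · obtain ⟨w, hw, hwK⟩ := hkT
        refine Metric.mem_cthickening_of_dist_le z w r K hwK ?_
        have := (hy k).2
        have := hstep k
        rw [Real.dist_eq, abs_le]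
        constructor <;> linarith [hz.1, hz.2, hw.1, hw.2]
      · simp [y, hkT] at hz
    rw [← measureReal_biUnion_finset
      (fun i _ j _ hij ↦ (hdisj hij).mono sdiff_subset sdiff_subset)
      (fun k _ ↦ measurableSet_Ioc.diff hK.measurableSet)
      (fun k _ ↦ measure_ne_top_of_subset sdiff_subset (by simp))]
    calc _ ≤ volume.real (Metric.cthickening r K \ K) :=
          measureReal_mono hsub (measure_ne_top_of_subset sdiff_subset hthick)
      _ = volume.real (Metric.cthickening r K) - volume.real K :=
          measureReal_sdiff (Metric.self_subset_cthickening K) hK.measurableSet hthick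
      _ < η := by
          have := (ENNReal.toReal_lt_toReal hthick (by finiteness)).2 hrη
          rw [ENNReal.toReal_add hKfin (by finiteness), ENNReal.toReal_ofReal hη.le] at this
          simp only [measureReal_def]
          linarith

/-- There is an increasing continuous function on `[a, b]` that is not absolutely continuous. -/
lemma exists_continuous_monotone_not_acOn {a b : ℝ} (hab : a < b) :
    ∃ F : ℝ → ℝ, Continuous F ∧ Monotone F ∧ ¬ ACOn F a b := by
  obtain ⟨K, hKab, hK, hKi, hKpos⟩ := exists_isCompact_subset_Icc_interior_eq_empty hab
  obtain ⟨g, hg⟩ := exists_orderIso_sub_eq_measureReal_sdiff hK hKi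
  have hs : 0 < (g b - g a) / (b - a) :=
    div_pos (sub_pos.2 (g.strictMono hab)) (sub_pos.2 hab)
  set s := (g b - g a) / (b - a) with hs_def
  have hsb : s * (b - a) = g b - g a := div_mul_cancel₀ _ (sub_pos.2 hab).ne'
  refine ⟨fun t ↦ g.symm (g a + s * (t - a)), ?_, ?_, fun hac ↦ ?_⟩
  · exact g.symm.continuous.comp (by fun_prop)
  · intro t t' htt'
    exact g.symm.monotone (by gcongr)
  obtain ⟨δ, hδ, h⟩ := hac (volume.real K) hKpos
  obtain ⟨N, x, y, hxy, hd, hsum, hsmall⟩ :=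
    exists_intervals_measureReal_le_and_sdiff_lt hab hK hKab (mul_pos hs hδ)
  let q : ℝ → ℝ := fun z ↦ a + (g z - g a) / s
  have hq : StrictMono q := fun z w hzw ↦ by
    have := g.strictMono hzw
    simp only [q]
    gcongr
  have hqa : q a = a := by simp [q]
  have hqb : q b = b := by
    simp only [q]
    rw [← hsb, mul_div_cancel_left₀ _ hs.ne']
    ring
  have hinv : ∀ z, g.symm (g a + s * (q z - a)) = z := fun z ↦ by
    have : g a + s * (q z - a) = g z := by simp only [q]; field_simp; ring
    rw [this, g.symm_apply_apply]
  have key := h N (fun i ↦ q (x i)) (fun i ↦ q (y i)) (fun i ↦ ⟨?_, hq.monotone (hxy i).2.1, ?_⟩)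
    ?_ ?_
  · simp only [hinv] at key
    refine (hsum.trans (Finset.sum_le_sum fun i _ ↦ le_abs_self _)).not_gt key
  · exact hqa ▸ hq.monotone (hxy i).1
  · exact hqb ▸ hq.monotone (hxy i).2.2
  · intro i j hij
    have := hd hij
    simp only [Ioo_disjoint_Ioo] at this ⊢
    rw [← hq.monotone.map_min, ← hq.monotone.map_max]
    exact hq.monotone this
  · have : ∀ i, q (y i) - q (x i) = volume.real (Ioc (x i) (y i) \ K) / s := fun i ↦ by
      rw [← hg _ _ (hxy i).2.1]
      simp only [q]
      ring
    simp only [this]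
    rw [← Finset.sum_div, div_lt_iff₀ hs]
    linarith

/-- The closure of `C¹(J)` in the continuous functions of bounded variation on a closed
interval `J`, with the total variation norm, is exactly the set of absolutely continuous
functions; in particular `C¹(J)` is not dense in `CBV(J)`. -/
theorem stmt_11 (a b : ℝ) (hab : a < b) :
    (∀ F : ℝ → ℝ, ContinuousOn F (Icc a b) → BoundedVariationOn F (Icc a b) →
      (C1Approx F a b ↔ ACOn F a b))
    ∧
    ∃ F : ℝ → ℝ, ContinuousOn F (Icc a b) ∧ BoundedVariationOn F (Icc a b) ∧
      ¬ C1Approx F a b := by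
  refine ⟨fun F _ hF ↦ ⟨acOn_of_c1Approx hab.le hF, c1Approx_of_acOn hab.le⟩, ?_⟩
  obtain ⟨F, hFc, hFm, hF⟩ := exists_continuous_monotone_not_acOn hab
  have hFbv : BoundedVariationOn F (Icc a b) := by
    simpa using (hFm.monotoneOn (Icc a b)).locallyBoundedVariationOn a b
      (left_mem_Icc.2 hab.le) (right_mem_Icc.2 hab.le)
  exact ⟨F, hFc.continuousOn, hFbv, fun h ↦ hF (acOn_of_c1Approx hab.le hFbv h)⟩
end

section
/- Let U be a connected neighborhood of an arc J in the plane ℝ². Then U \ J is connected. -/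
open Set

/-- A nowhere vanishing continuous function on a real topological vector space has a continuous
logarithm. -/
theorem exists_continuous_exp_eq {E : Type*} [NormedAddCommGroup E] [NormedSpace ℝ E]
    {g : E → ℂ} (hg : Continuous g) (h₀ : ∀ x, g x ≠ 0) :
    ∃ h : E → ℂ, Continuous h ∧ ∀ x, Complex.exp (h x) = g x := by
  obtain ⟨f, ⟨-, hf⟩, -⟩ := Complex.isCoveringMapOn_exp.existsUnique_continuousMap_lifts
    ⟨g, hg⟩ (a₀ := 0) (Complex.exp_log (h₀ 0)) h₀
  exact ⟨f, f.continuous, fun x => congrFun hf x⟩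

/-- Two continuous logarithms of the same function on a preconnected set differ by a constant. -/
theorem IsPreconnected.sub_eq_sub_of_exp_eq {X : Type*} [TopologicalSpace X] {S : Set X}
    (hS : IsPreconnected S) {f g : X → ℂ} (hf : ContinuousOn f S) (hg : ContinuousOn g S)
    (hfg : ∀ x ∈ S, Complex.exp (f x) = Complex.exp (g x)) {a b : X} (ha : a ∈ S) (hb : b ∈ S) :
    f a - g a = f b - g b := by
  have key : EqOn f (fun x => g x + (f a - g a)) S := by
    refine Complex.isCoveringMap_exp.eqOn_of_comp_eqOn hS hf (hg.add continuousOn_const) ?_ ha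
      (by simp)
    intro x hx
    simp [Complex.exp_add, Complex.exp_sub, hfg x hx, hfg a ha]
  have := key hb
  grind

/-- Two connected open sets covering a real normed space have a preconnected intersection. -/
theorem IsPreconnected.inter_of_union_eq_univ {E : Type*} [NormedAddCommGroup E]
    [NormedSpace ℝ E] {U W : Set E} (hUo : IsOpen U) (hWo : IsOpen W) (hU : IsPreconnected U)
    (hW : IsPreconnected W) (hUW : U ∪ W = univ) : IsPreconnected (U ∩ W) := by
  classical
  rintro A' B' hA' hB' hsub ⟨a, haUW, haA⟩ ⟨b, hbUW, hbB⟩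
  by_contra hne
  rw [not_nonempty_iff_eq_empty] at hne
  set A := (U ∩ W) ∩ A'
  set B := (U ∩ W) ∩ B'
  have hAo : IsOpen A := (hUo.inter hWo).inter hA'
  have hBo : IsOpen B := (hUo.inter hWo).inter hB'
  have hAB : Disjoint A B := by
    rw [Set.disjoint_left]
    rintro x ⟨hx, hxA⟩ ⟨-, hxB⟩
    exact (eq_empty_iff_forall_notMem.1 hne x) ⟨hx, hxA, hxB⟩
  have hfr : ∀ x ∈ frontier A, x ∈ U → x ∈ W → False := by
    intro x hx hxU hxW
    rcases hsub ⟨hxU, hxW⟩ with h | h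
    · rw [hAo.frontier_eq] at hx
      exact hx.2 ⟨⟨hxU, hxW⟩, h⟩
    · exact (hAB.closure_left hBo).le_bot ⟨frontier_subset_closure hx, ⟨⟨hxU, hxW⟩, h⟩⟩
  have hcov : ∀ x, x ∈ U ∨ x ∈ W := fun x => by
    have := mem_univ x
    rwa [← hUW] at this
  obtain ⟨χ, hχ0, hχ1, -⟩ := exists_continuous_zero_one_of_isClosed hWo.isClosed_compl
    hUo.isClosed_compl (Set.disjoint_left.2 fun x hx hx' => (hcov x).elim hx' hx)
  set c : ℂ := 2 * Real.pi * Complex.I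
  have hc : c ≠ 0 := Complex.two_pi_I_ne_zero
  have hexpc : Complex.exp c = 1 := Complex.exp_two_pi_mul_I
  let u : E → ℂ := fun x => if x ∈ A then c * χ x else 0
  let w : E → ℂ := fun x => if x ∈ A then c * (χ x - 1) else 0
  have hu : ContinuousOn u U := by
    refine ContinuousOn.if (fun x hx => ?_) (by fun_prop) (by fun_prop)
    have : χ x = 0 := hχ0 fun h => hfr x hx.2 hx.1 h
    simp [this]
  have hw : ContinuousOn w W := by
    refine ContinuousOn.if (fun x hx => ?_) (by fun_prop) (by fun_prop)
    have : χ x = 1 := hχ1 fun h => hfr x hx.2 h hx.1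
    simp [this]
  have huw : ∀ x, Complex.exp (w x) = Complex.exp (u x) := by
    intro x
    by_cases hx : x ∈ A
    · simp only [u, w, hx, if_true, mul_sub, mul_one, Complex.exp_sub, hexpc, div_one]
    · simp only [u, w, hx, if_false]
  have hcont : Continuous fun x => Complex.exp (u x) := by
    rw [continuous_iff_continuousAt]
    intro x
    rcases hcov x with hx | hx
    · exact (hu.cexp).continuousAt (hUo.mem_nhds hx)
    · simp_rw [← huw]
      exact (hw.cexp).continuousAt (hWo.mem_nhds hx)
  obtain ⟨h, hh, hexp⟩ := exists_continuous_exp_eq hcont fun x => Complex.exp_ne_zero _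
  have h1 := hU.sub_eq_sub_of_exp_eq hh.continuousOn hu (fun x _ => hexp x) haUW.1 hbUW.1
  have h2 := hW.sub_eq_sub_of_exp_eq hh.continuousOn hw (fun x _ => (hexp x).trans (huw x).symm)
    haUW.2 hbUW.2
  have haA' : a ∈ A := ⟨haUW, haA⟩
  have hbA' : b ∉ A := fun hb' => hAB.le_bot ⟨hb', ⟨hbUW, hbB⟩⟩
  simp only [u, w, haA', hbA', if_true, if_false] at h1 h2
  exact hc (by linear_combination h2 - h1)

/-- On a circle around `p`, the function `z - p` has no continuous logarithm. -/
theorem not_forall_exp_eq_sub {h : ℂ → ℂ} (hh : Continuous h) (p : ℂ) {r : ℝ} (hr : 0 < r) :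
    ¬ ∀ z, ‖z - p‖ = r → Complex.exp (h z) = z - p := by
  intro H
  have hE : ∀ t : ℝ, Complex.exp (h (p + r * Complex.exp (t * Complex.I))) =
      Complex.exp (Complex.log r + t * Complex.I) := by
    intro t
    rw [H _ (by simp [Complex.norm_exp_ofReal_mul_I, abs_of_pos hr]), Complex.exp_add,
      Complex.exp_log (by exact_mod_cast hr.ne')]
    ring
  have := isPreconnected_univ.sub_eq_sub_of_exp_eq
    (f := fun t : ℝ => h (p + r * Complex.exp (t * Complex.I)))
    (g := fun t : ℝ => Complex.log r + t * Complex.I)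
    (by fun_prop) (by fun_prop) (fun t _ => hE t) (mem_univ 0) (mem_univ (2 * Real.pi))
  have h2 : Complex.exp (((2 * Real.pi : ℝ) : ℂ) * Complex.I) = 1 := by
    push_cast
    exact Complex.exp_two_pi_mul_I
  simp only [h2, Complex.ofReal_zero, zero_mul, Complex.exp_zero] at this
  apply Complex.two_pi_I_ne_zero
  push_cast at this
  linear_combination this

theorem Complex.isPreconnected_norm_gt {R : ℝ} (hR : 0 ≤ R) :
    IsPreconnected {z : ℂ | R < ‖z‖} := by
  have hconv : IsPreconnected ((Ioi R) ×ˢ (univ : Set ℝ)) :=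
    isPreconnected_Ioi.prod isPreconnected_univ
  convert hconv.image (fun q : ℝ × ℝ => (q.1 : ℂ) * Complex.exp (q.2 * Complex.I))
    (by fun_prop) using 1
  ext z
  constructor
  · intro hz
    exact ⟨(‖z‖, z.arg), ⟨hz, mem_univ _⟩, Complex.norm_mul_exp_arg_mul_I z⟩
  · rintro ⟨⟨r, t⟩, ⟨hr, -⟩, rfl⟩
    have hr : R < r := hr
    simpa [Complex.norm_exp_ofReal_mul_I, abs_of_pos (hR.trans_lt hr)] using hr

/-- If for every `p ∉ K` the function `z - p` has a logarithm on `K` that extends continuously to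
`ℂ`, then no nonempty bounded open set splits off from the complement of `K`. -/
theorem eq_empty_of_isBounded_of_union_eq_compl {K A B : Set ℂ}
    (hlog : ∀ p ∉ K, ∃ θ : ℂ → ℂ, Continuous θ ∧ ∀ z ∈ K, Complex.exp (θ z) = z - p)
    (hA : IsOpen A) (hB : IsOpen B) (hAB : Disjoint A B) (hK : A ∪ B = Kᶜ) {R : ℝ}
    (hR : ∀ z ∈ A, ‖z‖ ≤ R) : A = ∅ := by
  classical
  by_contra hne
  obtain ⟨p, hp⟩ := nonempty_iff_ne_empty.2 hne
  have hpK : p ∉ K := hK.subset (Or.inl hp)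
  obtain ⟨θ, hθ, hexp⟩ := hlog p hpK
  have hg : Continuous fun z => if z ∈ A then Complex.exp (θ z) else z - p := by
    refine Continuous.if (fun z hz => hexp z ?_) (by fun_prop) (by fun_prop)
    replace hz : z ∈ frontier A := hz
    by_contra hzK
    rcases hK.superset hzK with h | h
    · rw [hA.frontier_eq] at hz
      exact hz.2 h
    · exact (hAB.closure_left hB).le_bot ⟨frontier_subset_closure hz, h⟩
  obtain ⟨h, hh, hh'⟩ := exists_continuous_exp_eq hg fun z => by
    split_ifs with hz
    · exact Complex.exp_ne_zero _
    · exact sub_ne_zero.2 fun h => hz (h ▸ hp)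
  have hR0 : 0 ≤ R := (norm_nonneg p).trans (hR p hp)
  refine not_forall_exp_eq_sub hh p (r := R + ‖p‖ + 1) (by positivity) fun z hz => ?_
  have hzA : z ∉ A := fun hzA => by
    have := norm_sub_le z p
    have := hR z hzA
    linarith
  rw [hh', if_neg hzA]

/-- An arc does not separate the plane. -/
theorem isPreconnected_compl_arc {φ : ℝ → ℂ} (hφc : ContinuousOn φ (Icc 0 1))
    (hφi : InjOn φ (Icc 0 1)) : IsPreconnected (φ '' Icc 0 1)ᶜ := by
  set K := φ '' Icc 0 1
  have hKc : IsCompact K := isCompact_Icc.image_of_continuousOn hφc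
  have hemb : Topology.IsClosedEmbedding (fun t : Icc (0 : ℝ) 1 => φ t) :=
    (continuousOn_iff_continuous_domRestrict.1 hφc).isClosedEmbedding
      (injOn_iff_injective.1 hφi)
  have hlog : ∀ p ∉ K, ∃ θ : ℂ → ℂ, Continuous θ ∧ ∀ z ∈ K, Complex.exp (θ z) = z - p := by
    intro p hp
    have hcont : Continuous fun t : ℝ => φ (projIcc 0 1 zero_le_one t) - p :=
      (hemb.continuous.comp continuous_projIcc).sub continuous_const
    obtain ⟨h, hh, hexp⟩ := exists_continuous_exp_eq hcont fun t =>
      sub_ne_zero.2 fun h => hp (h ▸ mem_image_of_mem φ (projIcc 0 1 zero_le_one t).2)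
    obtain ⟨θ, hθ⟩ := ContinuousMap.exists_extension' hemb
      (⟨fun t : Icc (0 : ℝ) 1 => h t, by fun_prop⟩ : C(Icc (0 : ℝ) 1, ℂ))
    refine ⟨θ, θ.continuous, ?_⟩
    rintro _ ⟨t, ht, rfl⟩
    have : θ (φ t) = h t := congrFun hθ ⟨t, ht⟩
    rw [this, hexp, projIcc_of_mem zero_le_one ht]
  obtain ⟨R, hR⟩ := hKc.isBounded.exists_norm_le
  have hconn := Complex.isPreconnected_norm_gt (abs_nonneg R)
  have hsub : {z : ℂ | |R| < ‖z‖} ⊆ Kᶜ := fun z hz hzK =>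
    absurd ((hR z hzK).trans (le_abs_self R)) (not_le.2 hz)
  rw [isPreconnected_iff_subset_of_disjoint]
  intro A B hA hB hcov hdisj
  have hKo : IsOpen Kᶜ := hKc.isClosed.isOpen_compl
  have key : ∀ A B : Set ℂ, IsOpen A → IsOpen B → Kᶜ ⊆ A ∪ B → Kᶜ ∩ (A ∩ B) = ∅ →
      {z : ℂ | |R| < ‖z‖} ⊆ B → Kᶜ ⊆ B := by
    intro A B hA hB hcov hdisj hRB
    have hd : ∀ z, z ∉ K → z ∈ A → z ∉ B := fun z hz hzA hzB =>
      eq_empty_iff_forall_notMem.1 hdisj z ⟨hz, hzA, hzB⟩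
    have := eq_empty_of_isBounded_of_union_eq_compl hlog (hKo.inter hA) (hKo.inter hB)
      (Set.disjoint_left.2 fun z h h' => hd z h.1 h.2 h'.2)
      (by rw [← inter_union_distrib_left, inter_eq_left.2 hcov]) (R := |R|)
      (fun z hz => by
        by_contra hlt
        exact hd z hz.1 hz.2 (hRB (not_le.1 hlt)))
    intro z hz
    exact (hcov hz).resolve_left fun hzA => eq_empty_iff_forall_notMem.1 this z ⟨hz, hzA⟩
  rcases isPreconnected_iff_subset_of_disjoint.1 hconn A B hA hB (hsub.trans hcov)
    (subset_empty_iff.1 (hdisj ▸ inter_subset_inter_left _ hsub)) with h | h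
  · exact Or.inl (key B A hB hA (union_comm A B ▸ hcov) (inter_comm A B ▸ hdisj) h)
  · exact Or.inr (key A B hA hB hcov hdisj h)

/-- If `U` is a connected open neighborhood of an arc `J` in the plane, then `U \ J` is
connected. -/
theorem stmt_14 (U : Set (EuclideanSpace ℝ (Fin 2))) (hUo : IsOpen U) (hUc : IsConnected U)
    (φ : ℝ → EuclideanSpace ℝ (Fin 2)) (hφc : ContinuousOn φ (Icc 0 1))
    (hφi : InjOn φ (Icc 0 1)) (J : Set (EuclideanSpace ℝ (Fin 2)))
    (hJ : J = φ '' Icc 0 1) (hJU : J ⊆ U) :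
    IsConnected (U \ J) := by
  have hJc : IsCompact J := hJ ▸ isCompact_Icc.image_of_continuousOn hφc
  refine ⟨nonempty_iff_ne_empty.2 fun h => ?_, ?_⟩
  · have hUJ : U = J := (sdiff_eq_empty.1 h).antisymm hJU
    have hclopen : IsClopen U := ⟨hUJ ▸ hJc.isClosed, hUo⟩
    have huniv : J = univ := hUJ ▸ hclopen.eq_univ hUc.nonempty
    exact noncompact_univ _ (huniv ▸ hJc)
  · let e : EuclideanSpace ℝ (Fin 2) ≃ₜ ℂ :=
      Complex.orthonormalBasisOneI.repr.symm.toHomeomorph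
    have hC := isPreconnected_compl_arc (e.continuous.comp_continuousOn hφc)
      (e.injective.comp_injOn hφi)
    rw [image_comp, ← hJ, ← e.image_compl, e.isPreconnected_image] at hC
    refine hUc.isPreconnected.inter_of_union_eq_univ hUo hJc.isClosed.isOpen_compl hC ?_
    exact eq_univ_of_forall fun x => or_iff_not_imp_left.2 fun hx hxJ => hx (hJU hxJ)
end
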